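/- Suppose the Borel probability measure α on Ω is quasi-C*-Gibbs for a Hölder potential U. Then there exist constants b₁, b₂ > 0 such that for all integers r, s ≥ 1 and every word w = (w₁,…,w_{r+s+1}) ∈ {1,…,d}^{r+s+1}, writing C = {z ∈ Ω : z_{j} = w_{j+r+1} for −r ≤ j ≤ s} and C' = {z ∈ Ω : z_{j} = w_{j} for 1 ≤ j ≤ r+s+1}, one has b₁ α(C) ≤ α(C') ≤ b₂ α(C). In particular α(C) > 0 if and only if α(C') > 0. -/

import Mathlib

open MeasureTheory Filter
open scoped ENNReal

noncomputable section

/-- The two-sided full shift space `Ω = {1,…,d}^ℤ` (alphabet `Fin d`). -/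
abbrev Omega (d : ℕ) : Type := ℤ → Fin d

/-- The shift map `τ`, `(τ x) j = x (j+1)`. -/
def tau (d : ℕ) (x : Omega d) : Omega d := fun j => x (j + 1)

/-- The `k`-th iterate of the shift (`k ∈ ℤ`): `(τ^k x) j = x (j + k)`. -/
def tauZ (d : ℕ) (k : ℤ) (x : Omega d) : Omega d := fun j => x (j + k)

/-- `x` and `y` are homoclinic: they differ in only finitely many coordinates. -/
def Homoclinic (d : ℕ) (x y : Omega d) : Prop := Set.Finite {j : ℤ | x j ≠ y j}

/-- `U` is Hölder continuous for the standard metric `dist x y = 2^{-N}`: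
there are `C > 0` and `0 < θ < 1` with `|U x - U y| ≤ C θ^N` whenever
`x` and `y` agree on all coordinates `|j| ≤ N`. -/
def HolderPotential (d : ℕ) (U : Omega d → ℝ) : Prop :=
  ∃ C θ : ℝ, 0 < C ∧ 0 < θ ∧ θ < 1 ∧
    ∀ (x y : Omega d) (N : ℕ), (∀ j : ℤ, |j| ≤ (N : ℤ) → x j = y j) →
      |U x - U y| ≤ C * θ ^ N

/-- `U` depends on only finitely many coordinates. -/
def FiniteRange (d : ℕ) (U : Omega d → ℝ) : Prop :=
  ∃ s : Finset ℤ, ∀ x y : Omega d, (∀ j ∈ s, x j = y j) → U x = U y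

/-- `V(x,y) = ∑_{k ∈ ℤ} (U(τ^k x) - U(τ^k y))`. -/
def Vfun (d : ℕ) (U : Omega d → ℝ) (x y : Omega d) : ℝ :=
  ∑' k : ℤ, (U (tauZ d k x) - U (tauZ d k y))

/-- The cylinder `{z : z_j = a_j for -n ≤ j ≤ m}`. -/
def cyl (d : ℕ) (n m : ℕ) (a : ℤ → Fin d) : Set (Omega d) :=
  {z | ∀ j : ℤ, -(n : ℤ) ≤ j → j ≤ (m : ℤ) → z j = a j}

/-- The conjugating homeomorphism with window `-n ≤ j ≤ m` and target word `b`: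
it replaces the coordinates in the window by those of `b` and keeps the rest. -/
def conjMap (d : ℕ) (n m : ℕ) (b : ℤ → Fin d) (z : Omega d) : Omega d :=
  fun j => if -(n : ℤ) ≤ j ∧ j ≤ (m : ℤ) then b j else z j

/-- `α` is a C*-Gibbs measure for `U` (at inverse temperature `β = 1`):
for every symmetric conjugating homeomorphism `(O, φ)` and every continuous
`f : Ω → ℂ`, `∫_O e^{-V(z, φ z)} f(φ z) dα = ∫_{φ(O)} f dα`. -/
def CStarGibbs (d : ℕ) (U : Omega d → ℝ) (α : Measure (Omega d)) : Prop :=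
  ∀ n : ℕ, 1 ≤ n → ∀ (a b : ℤ → Fin d) (f : Omega d → ℂ), Continuous f →
    ∫ z in cyl d n n a,
        (Real.exp (-(Vfun d U z (conjMap d n n b z))) : ℂ) * f (conjMap d n n b z) ∂α
      = ∫ z in cyl d n n b, f z ∂α

/-- `α` is a quasi-C*-Gibbs measure for `U`: there are constants `d₁, d₂ > 0`
such that for every conjugating homeomorphism `(O, φ)` and every nonnegative
continuous `f : Ω → ℝ`,
`d₁ ∫_O e^{-V(z,φz)} f(φ z) dα ≤ ∫_{φ(O)} f dα ≤ d₂ ∫_O e^{-V(z,φz)} f(φ z) dα`. -/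
def QuasiCStarGibbs (d : ℕ) (U : Omega d → ℝ) (α : Measure (Omega d)) : Prop :=
  ∃ d₁ d₂ : ℝ, 0 < d₁ ∧ 0 < d₂ ∧
    ∀ (n m : ℕ), 1 ≤ n → 1 ≤ m → ∀ (a b : ℤ → Fin d) (f : Omega d → ℝ),
      Continuous f → (∀ z, 0 ≤ f z) →
      (d₁ * ∫ z in cyl d n m a,
          Real.exp (-(Vfun d U z (conjMap d n m b z))) * f (conjMap d n m b z) ∂α
        ≤ ∫ z in cyl d n m b, f z ∂α) ∧
      (∫ z in cyl d n m b, f z ∂α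
        ≤ d₂ * ∫ z in cyl d n m a,
            Real.exp (-(Vfun d U z (conjMap d n m b z))) * f (conjMap d n m b z) ∂α)

/-- The future cylinder `{z : z_k = a_k for 1 ≤ k ≤ s}`. -/
def futureCyl (d : ℕ) (s : ℕ) (a : ℕ → Fin d) : Set (Omega d) :=
  {z | ∀ k : ℕ, 1 ≤ k → k ≤ s → z (k : ℤ) = a k}

/-- The Birkhoff sum `∑_{k=0}^{s-1} U(τ^k x)`. -/
def birkhoff (d : ℕ) (U : Omega d → ℝ) (s : ℕ) (x : Omega d) : ℝ :=
  ∑ k ∈ Finset.range s, U (tauZ d (k : ℤ) x)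

/-- `ρ` is the equilibrium (Gibbs) probability for `U`: it is `τ`-invariant and
satisfies Bowen's inequalities. -/
def IsEquilibrium (d : ℕ) (U : Omega d → ℝ) (ρ : Measure (Omega d)) : Prop :=
  Measure.map (tau d) ρ = ρ ∧
  ∃ C₁ C₂ P : ℝ, 0 < C₁ ∧ 0 < C₂ ∧
    ∀ s : ℕ, 1 ≤ s → ∀ (a : ℕ → Fin d) (x : Omega d),
      (∀ k : ℕ, 1 ≤ k → k ≤ s → x (k : ℤ) = a k) →
      C₁ ≤ (ρ (futureCyl d s a)).toReal * Real.exp (P * s - birkhoff d U s x) ∧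
      (ρ (futureCyl d s a)).toReal * Real.exp (P * s - birkhoff d U s x) ≤ C₂

/-- The point whose coordinates `1, 2, 3, …` are `j, x₁, x₂, …`. -/
def prepend (d : ℕ) (j : Fin d) (x : Omega d) : Omega d :=
  fun k => if k = 1 then j else x (k - 1)

/-- A potential depending on the coordinates `x₁, …, x_r` is normalized if
`∑_{j=1}^d exp(f(j, x₁, …, x_{r-1})) = 1` for all choices of `x₁, …, x_{r-1}`. -/
def Normalized (d : ℕ) (U : Omega d → ℝ) : Prop :=
  ∀ x : Omega d, ∑ j : Fin d, Real.exp (U (prepend d j x)) = 1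

/-- The permutation of `ℤ` that is the identity off `[-r, r + s + 1]` and, on this window,
reads the block `[-r, s]` at the positions `[1, r + s + 1]` and the block `[s + 1, r + s + 1]`
at the positions `[-r, 0]`. -/
def blockSwap (r s : ℕ) : Equiv.Perm ℤ where
  toFun j :=
    if j < -(r : ℤ) then j
    else if j ≤ 0 then j + (r + s + 1)
    else if j ≤ r + s + 1 then j - (r + 1)
    else j
  invFun j :=
    if j < -(r : ℤ) then j
    else if j ≤ s then j + (r + 1)
    else if j ≤ r + s + 1 then j - (r + s + 1)
    else j
  left_inv j := by grind
  right_inv j := by grind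

theorem blockSwap_apply (r s : ℕ) (j : ℤ) : blockSwap r s j =
    if j < -(r : ℤ) then j
    else if j ≤ 0 then j + (r + s + 1)
    else if j ≤ r + s + 1 then j - (r + 1)
    else j := rfl

theorem blockSwap_mem_Icc_iff (r s : ℕ) (j : ℤ) :
    blockSwap r s j ∈ Finset.Icc (-(r : ℤ)) (r + s + 1 : ℕ) ↔
      j ∈ Finset.Icc (-(r : ℤ)) (r + s + 1 : ℕ) := by
  simp only [blockSwap_apply, Finset.mem_Icc]
  grind

theorem HolderPotential.continuous {d : ℕ} {U : Omega d → ℝ} (hU : HolderPotential d U) :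
    Continuous U := by
  obtain ⟨C, θ, hC, hθ, hθ1, h⟩ := hU
  refine continuous_iff_continuousAt.2 fun x => Metric.tendsto_nhds.2 fun ε hε => ?_
  have ht : Tendsto (fun N : ℕ => C * θ ^ N) atTop (nhds 0) := by
    simpa using (tendsto_pow_atTop_nhds_zero_of_lt_one hθ.le hθ1).const_mul C
  obtain ⟨N, hN⟩ := (ht.eventually (gt_mem_nhds hε)).exists
  have hx : ∀ᶠ y : Omega d in nhds x, ∀ j ∈ Finset.Icc (-(N : ℤ)) N, y j = x j := by
    refine (Finset.eventually_all _).2 fun j _ => ?_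
    exact (continuous_apply j).continuousAt.eventually
      ((isOpen_discrete {x j}).mem_nhds rfl)
  filter_upwards [hx] with y hy
  rw [Real.dist_eq]
  exact (h y x N fun j hj => hy j (Finset.mem_Icc.2 (abs_le.1 hj))).trans_lt hN

theorem summable_pow_natAbs {θ : ℝ} (h0 : 0 < θ) (h1 : θ < 1) :
    Summable fun k : ℤ => θ ^ k.natAbs :=
  summable_int_iff_summable_nat_and_neg.2
    ⟨by simpa using summable_geometric_of_lt_one h0.le h1,
      by simpa using summable_geometric_of_lt_one h0.le h1⟩

/-- The shifts of `z` by `blockSwap r s k` and of `z ∘ blockSwap r s` by `k` agree up to the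
distance from `k` to the nearest end of a block. -/
theorem abs_sub_blockSwap_le {d : ℕ} {U : Omega d → ℝ} {C θ : ℝ} (hC : 0 < C) (hθ : 0 < θ)
    (hθ1 : θ < 1)
    (h : ∀ (x y : Omega d) (N : ℕ), (∀ j : ℤ, |j| ≤ (N : ℤ) → x j = y j) →
      |U x - U y| ≤ C * θ ^ N)
    (r s : ℕ) (z : Omega d) (k : ℤ) :
    |U (tauZ d (blockSwap r s k) z) - U (tauZ d k (z ∘ blockSwap r s))| ≤
      C / θ * (θ ^ (k + r).natAbs + θ ^ k.natAbs + θ ^ (k - (r + s + 1)).natAbs) := by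
  set M : ℕ := min (k + r).natAbs (min k.natAbs (k - (r + s + 1)).natAbs) with hM
  have key : |U (tauZ d (blockSwap r s k) z) - U (tauZ d k (z ∘ blockSwap r s))| ≤
      C * θ ^ (M - 1) := by
    refine h _ _ _ fun j hj => ?_
    rw [abs_le] at hj
    simp only [tauZ, Function.comp_apply]
    congr 1
    simp only [blockSwap_apply]
    split_ifs <;> omega
  have hpow : θ ^ (M - 1) ≤ θ ^ M / θ := by
    rw [le_div_iff₀ hθ, ← pow_succ]
    exact pow_le_pow_of_le_one hθ.le hθ1.le (by omega)
  have hsum : θ ^ M ≤ θ ^ (k + r).natAbs + θ ^ k.natAbs + θ ^ (k - (r + s + 1)).natAbs := by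
    have h₁ : 0 < θ ^ (k + r).natAbs := by positivity
    have h₂ : 0 < θ ^ k.natAbs := by positivity
    have h₃ : 0 < θ ^ (k - (r + s + 1)).natAbs := by positivity
    have : M = (k + r).natAbs ∨ M = k.natAbs ∨ M = (k - (r + s + 1)).natAbs := by omega
    rcases this with e | e | e <;> rw [e] <;> linarith
  calc _ ≤ C * θ ^ (M - 1) := key
    _ ≤ C * (θ ^ M / θ) := by gcongr
    _ = C / θ * θ ^ M := by ring
    _ ≤ _ := by gcongr

theorem hasSum_sub_blockSwap (r s : ℕ) (g : ℤ → ℝ) :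
    HasSum (fun k => g k - g (blockSwap r s k)) 0 := by
  have hfix : ∀ k ∉ Finset.Icc (-(r : ℤ)) (r + s + 1), blockSwap r s k = k := by
    intro k hk
    simp only [Finset.mem_Icc] at hk
    simp only [blockSwap_apply]
    grind
  have := hasSum_sum_of_ne_finset_zero (f := fun k => g k - g (blockSwap r s k))
    (s := Finset.Icc (-(r : ℤ)) (r + s + 1)) (L := SummationFilter.unconditional ℤ)
    fun k hk => by simp [hfix k hk]
  rwa [Finset.sum_sub_distrib, (blockSwap r s).sum_comp _ g
    fun k hk => by_contra fun hk' => hk (hfix k hk'), sub_self] at this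

theorem Vfun_comp_blockSwap {d : ℕ} {U : Omega d → ℝ} {r s : ℕ} {z : Omega d}
    (h : Summable fun k : ℤ =>
      U (tauZ d (blockSwap r s k) z) - U (tauZ d k (z ∘ blockSwap r s))) :
    Vfun d U z (z ∘ blockSwap r s) =
      ∑' k : ℤ, (U (tauZ d (blockSwap r s k) z) - U (tauZ d k (z ∘ blockSwap r s))) := by
  have := (hasSum_sub_blockSwap r s fun k => U (tauZ d k z)).add h.hasSum
  simp only [sub_add_sub_cancel, zero_add] at this
  exact this.tsum_eq

/-- Swapping adjacent blocks changes the energy by an amount bounded independently of the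
lengths of the blocks. -/
theorem HolderPotential.exists_abs_Vfun_comp_blockSwap_le {d : ℕ} {U : Omega d → ℝ}
    (hU : HolderPotential d U) :
    ∃ K : ℝ, ∀ r s : ℕ, (Continuous fun z => Vfun d U z (z ∘ blockSwap r s)) ∧
      ∀ z, |Vfun d U z (z ∘ blockSwap r s)| ≤ K := by
  have hcont := hU.continuous
  obtain ⟨C, θ, hC, hθ, hθ1, h⟩ := hU
  obtain ⟨S, hasS⟩ := summable_pow_natAbs hθ hθ1
  refine ⟨C / θ * (S + S + S), fun r s => ?_⟩
  have hshift (c : ℤ) : HasSum (fun k : ℤ => θ ^ (k + c).natAbs) S :=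
    (Equiv.addRight c).hasSum_iff (f := fun k : ℤ => θ ^ k.natAbs) |>.2 hasS
  have hbound : HasSum (fun k : ℤ => C / θ *
      (θ ^ (k + r).natAbs + θ ^ k.natAbs + θ ^ (k - (r + s + 1)).natAbs))
      (C / θ * (S + S + S)) :=
    (((hshift r).add hasS).add (hshift (-(r + s + 1)))).mul_left _
  have hterm := abs_sub_blockSwap_le hC hθ hθ1 h r s
  have hV (z : Omega d) : Vfun d U z (z ∘ blockSwap r s) =
      ∑' k : ℤ, (U (tauZ d (blockSwap r s k) z) - U (tauZ d k (z ∘ blockSwap r s))) :=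
    Vfun_comp_blockSwap (.of_norm_bounded hbound.summable (hterm z))
  constructor
  · simp only [hV]
    refine continuous_tsum (fun k => ?_) hbound.summable fun k z => hterm z k
    refine (hcont.comp ?_).sub (hcont.comp ?_)
    · exact continuous_pi fun j => continuous_apply _
    · exact continuous_pi fun j => continuous_apply _
  · intro z
    rw [hV, ← Real.norm_eq_abs]
    exact tsum_of_norm_bounded hbound (hterm z)

theorem measurableSet_cyl (d n m : ℕ) (a : ℤ → Fin d) : MeasurableSet (cyl d n m a) := by
  have : cyl d n m a = ⋂ j : ℤ, ⋂ (_ : -(n : ℤ) ≤ j), ⋂ (_ : j ≤ (m : ℤ)),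
      (fun z : Omega d => z j) ⁻¹' {a j} := by
    ext z
    simp [cyl]
  rw [this]
  exact .iInter fun j => .iInter fun _ => .iInter fun _ =>
    measurable_pi_apply j (measurableSet_singleton _)

theorem conjMap_comp_blockSwap {d r s : ℕ} {a : ℤ → Fin d} {z : Omega d}
    (hz : z ∈ cyl d r (r + s + 1) a) :
    conjMap d r (r + s + 1) (a ∘ blockSwap r s) z = z ∘ blockSwap r s := by
  funext j
  simp only [conjMap, Function.comp_apply]
  split_ifs with hj
  · have := (blockSwap_mem_Icc_iff r s j).2 (by simpa using hj)
    rw [Finset.mem_Icc] at this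
    exact (hz _ this.1 this.2).symm
  · rw [blockSwap_apply]
    push_cast at hj
    congr 1
    split_ifs <;> omega

theorem QuasiCStarGibbs.exists_cyl_blockSwap_comparison {d : ℕ} {U : Omega d → ℝ}
    {α : Measure (Omega d)} [IsProbabilityMeasure α] (h : QuasiCStarGibbs d U α)
    (hU : HolderPotential d U) :
    ∃ b₁ b₂ : ℝ, 0 < b₁ ∧ 0 < b₂ ∧ ∀ r s : ℕ, 1 ≤ r → ∀ a : ℤ → Fin d,
      b₁ * α.real (cyl d r (r + s + 1) a) ≤
        α.real (cyl d r (r + s + 1) (a ∘ blockSwap r s)) ∧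
      α.real (cyl d r (r + s + 1) (a ∘ blockSwap r s)) ≤
        b₂ * α.real (cyl d r (r + s + 1) a) := by
  obtain ⟨d₁, d₂, hd₁, hd₂, h⟩ := h
  obtain ⟨K, hK⟩ := hU.exists_abs_Vfun_comp_blockSwap_le
  refine ⟨d₁ * Real.exp (-K), d₂ * Real.exp K, by positivity, by positivity,
    fun r s hr a => ?_⟩
  obtain ⟨hcont, hb⟩ := hK r s
  obtain ⟨h₁, h₂⟩ := h r (r + s + 1) hr (by omega) a (a ∘ blockSwap r s) (fun _ => 1)
    continuous_const fun _ => zero_le_one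
  have hcyl := measurableSet_cyl d r (r + s + 1) a
  have hint : ∫ z in cyl d r (r + s + 1) a,
      Real.exp (-(Vfun d U z (conjMap d r (r + s + 1) (a ∘ blockSwap r s) z))) * 1 ∂α =
      ∫ z in cyl d r (r + s + 1) a, Real.exp (-(Vfun d U z (z ∘ blockSwap r s))) ∂α :=
    setIntegral_congr_fun hcyl fun z hz => by
      simp only [mul_one, conjMap_comp_blockSwap hz]
  have hI : IntegrableOn (fun z => Real.exp (-(Vfun d U z (z ∘ blockSwap r s))))
      (cyl d r (r + s + 1) a) α :=
    (hcont.neg.rexp.integrable_of_hasCompactSupport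
      (HasCompactSupport.of_compactSpace _)).integrableOn
  have hconst (c : ℝ) : ∫ _ in cyl d r (r + s + 1) a, c ∂α =
      c * α.real (cyl d r (r + s + 1) a) := by
    simp [mul_comm]
  have hlow := setIntegral_mono_on (integrable_const (Real.exp (-K))).integrableOn hI hcyl
    fun z _ => Real.exp_le_exp.2 (neg_le_neg (abs_le.1 (hb z)).2)
  have hupp := setIntegral_mono_on hI (integrable_const (Real.exp K)).integrableOn hcyl
    fun z _ => Real.exp_le_exp.2 (neg_le.1 (abs_le.1 (hb z)).1)
  rw [hconst] at hlow hupp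
  rw [hint] at h₁ h₂
  have hone : ∫ _ in cyl d r (r + s + 1) (a ∘ blockSwap r s), (1 : ℝ) ∂α =
      α.real (cyl d r (r + s + 1) (a ∘ blockSwap r s)) := by simp
  rw [hone] at h₁ h₂
  constructor
  · rw [mul_assoc]
    exact (mul_le_mul_of_nonneg_left hlow hd₁.le).trans h₁
  · rw [mul_assoc]
    exact h₂.trans (mul_le_mul_of_nonneg_left hupp hd₂.le)

/-- The measure of an event depending on the window `[-n, m]` only is the sum of the measures of
the cylinders contained in it. -/
theorem measureReal_restrict_preimage_eq_sum_cyl {d : ℕ} [NeZero d] (α : Measure (Omega d))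
    [IsFiniteMeasure α] (n m : ℕ) (S : Finset (Finset.Icc (-(n : ℤ)) m → Fin d)) :
    α.real ((Finset.Icc (-(n : ℤ)) m).restrict ⁻¹' (S : Set _)) =
      ∑ v ∈ S, α.real (cyl d n m
        fun j => if h : j ∈ Finset.Icc (-(n : ℤ)) m then v ⟨j, h⟩ else 0) := by
  rw [← sum_measureReal_preimage_singleton]
  · refine Finset.sum_congr rfl fun v _ => congrArg α.real ?_
    ext z
    simp only [Set.mem_preimage, Set.mem_singleton_iff, funext_iff, Subtype.forall,
      Finset.restrict_def, cyl, Set.mem_ofPred_eq, Finset.mem_Icc]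
    grind
  · exact fun v _ => Finset.measurable_restrict _ (measurableSet_singleton v)

/-- Transport of events depending on the window `[-r, r + s + 1]` by `blockSwap r s`. -/
theorem cylinder_comparison_of_blockSwap {d : ℕ} [NeZero d] {α : Measure (Omega d)}
    [IsFiniteMeasure α] {b₁ b₂ : ℝ} {r s : ℕ}
    (h : ∀ a : ℤ → Fin d,
      b₁ * α.real (cyl d r (r + s + 1) a) ≤
        α.real (cyl d r (r + s + 1) (a ∘ blockSwap r s)) ∧
      α.real (cyl d r (r + s + 1) (a ∘ blockSwap r s)) ≤
        b₂ * α.real (cyl d r (r + s + 1) a))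
    (w : ℤ → Fin d) :
    b₁ * α.real {z : Omega d | ∀ j : ℤ, -(r : ℤ) ≤ j → j ≤ (s : ℤ) → z j = w (j + r + 1)} ≤
        α.real {z : Omega d | ∀ j : ℤ, 1 ≤ j → j ≤ (r : ℤ) + s + 1 → z j = w j} ∧
      α.real {z : Omega d | ∀ j : ℤ, 1 ≤ j → j ≤ (r : ℤ) + s + 1 → z j = w j} ≤
        b₂ * α.real {z : Omega d | ∀ j : ℤ, -(r : ℤ) ≤ j → j ≤ (s : ℤ) →
          z j = w (j + r + 1)} := by
  classical
  let I := Finset.Icc (-(r : ℤ)) (r + s + 1 : ℕ)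
  let σ : Equiv.Perm I := (blockSwap r s).subtypePerm (blockSwap_mem_Icc_iff r s)
  let e : (I → Fin d) ≃ (I → Fin d) := σ.symm.arrowCongr (Equiv.refl _)
  let S : Finset (I → Fin d) :=
    {v | ∀ j : I, j.1 ≤ (s : ℤ) → v j = w (j + r + 1)}
  let S' : Finset (I → Fin d) := {v | ∀ j : I, 1 ≤ j.1 → v j = w j}
  have hσ (j : I) : (σ j : ℤ) = blockSwap r s j := rfl
  have he (v : I → Fin d) (j : I) : e v j = v (σ j) := rfl
  have hS : {z : Omega d | ∀ j : ℤ, -(r : ℤ) ≤ j → j ≤ (s : ℤ) → z j = w (j + r + 1)} =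
      I.restrict ⁻¹' (S : Set (I → Fin d)) := by
    ext z
    simp only [S, Set.mem_ofPred_eq, Set.mem_preimage, Finset.coe_filter, Finset.mem_univ,
      true_and, Finset.restrict_def, Subtype.forall, I, Finset.mem_Icc]
    exact ⟨fun hz j hj hjs => hz j hj.1 hjs, fun hz j hj hjs => hz j ⟨hj, by omega⟩ hjs⟩
  have hS' : {z : Omega d | ∀ j : ℤ, 1 ≤ j → j ≤ (r : ℤ) + s + 1 → z j = w j} =
      I.restrict ⁻¹' (S' : Set (I → Fin d)) := by
    ext z
    simp only [S', Set.mem_ofPred_eq, Set.mem_preimage, Finset.coe_filter, Finset.mem_univ,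
      true_and, Finset.restrict_def, Subtype.forall, I, Finset.mem_Icc]
    exact ⟨fun hz j hj hj1 => hz j hj1 (by omega),
      fun hz j hj1 hj => hz j ⟨by omega, by omega⟩ hj1⟩
  have hmem (v : I → Fin d) : v ∈ S ↔ e v ∈ S' := by
    simp only [S, S', Finset.mem_filter, Finset.mem_univ, true_and, he]
    constructor
    · intro hv j hj
      have hjI := Finset.mem_Icc.1 j.2
      have hj' : (σ j : ℤ) = j - (r + 1) := by
        rw [hσ, blockSwap_apply]
        split_ifs <;> omega
      rw [hv (σ j) (by omega), hj']
      congr 1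
      ring
    · intro hv j hj
      obtain ⟨i, rfl⟩ := σ.surjective j
      have hiI := Finset.mem_Icc.1 i.2
      rw [hσ, blockSwap_apply] at hj
      have hi : 1 ≤ i.1 := by
        by_contra hi
        split_ifs at hj <;> omega
      have hi' : (σ i : ℤ) = i - (r + 1) := by
        rw [hσ, blockSwap_apply]
        split_ifs <;> omega
      rw [hv i hi, hi']
      congr 1
      ring
  let extend (v : I → Fin d) (j : ℤ) : Fin d := if h : j ∈ I then v ⟨j, h⟩ else 0
  have hext (v : I → Fin d) : extend (e v) = extend v ∘ blockSwap r s := by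
    funext j
    simp only [extend, Function.comp_apply, I, blockSwap_mem_Icc_iff]
    rfl
  have hsum : ∑ v ∈ S', α.real (cyl d r (r + s + 1) (extend v)) =
      ∑ v ∈ S, α.real (cyl d r (r + s + 1) (extend v ∘ blockSwap r s)) :=
    (Finset.sum_equiv e hmem fun v _ => by rw [hext]).symm
  rw [hS, hS', measureReal_restrict_preimage_eq_sum_cyl,
    measureReal_restrict_preimage_eq_sum_cyl, hsum, Finset.mul_sum, Finset.mul_sum]
  exact ⟨Finset.sum_le_sum fun v _ => (h _).1, Finset.sum_le_sum fun v _ => (h _).2⟩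

/-- for a quasi-C*-Gibbs `α` there are `b₁, b₂ > 0` comparing the
measure of the two-sided cylinder `C = {z_j = w_{j+r+1}, -r ≤ j ≤ s}` with that
of the future cylinder `C' = {z_j = w_j, 1 ≤ j ≤ r+s+1}`; in particular one is
positive iff the other is. -/
theorem quasiGibbs_cylinder_comparison (d : ℕ) (hd : 2 ≤ d) (U : Omega d → ℝ)
    (hU : HolderPotential d U) (α : Measure (Omega d)) (hα : IsProbabilityMeasure α)
    (h : QuasiCStarGibbs d U α) :
    ∃ b₁ b₂ : ℝ, 0 < b₁ ∧ 0 < b₂ ∧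
      ∀ (r s : ℕ), 1 ≤ r → 1 ≤ s → ∀ w : ℤ → Fin d,
        (b₁ * (α {z : Omega d | ∀ j : ℤ, -(r : ℤ) ≤ j → j ≤ (s : ℤ) →
              z j = w (j + r + 1)}).toReal
            ≤ (α {z : Omega d | ∀ j : ℤ, 1 ≤ j → j ≤ ((r : ℤ) + s + 1) →
              z j = w j}).toReal) ∧
        ((α {z : Omega d | ∀ j : ℤ, 1 ≤ j → j ≤ ((r : ℤ) + s + 1) →
              z j = w j}).toReal
            ≤ b₂ * (α {z : Omega d | ∀ j : ℤ, -(r : ℤ) ≤ j → j ≤ (s : ℤ) →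
              z j = w (j + r + 1)}).toReal) ∧
        (0 < α {z : Omega d | ∀ j : ℤ, -(r : ℤ) ≤ j → j ≤ (s : ℤ) →
            z j = w (j + r + 1)} ↔
          0 < α {z : Omega d | ∀ j : ℤ, 1 ≤ j → j ≤ ((r : ℤ) + s + 1) →
            z j = w j}) := by
  have : NeZero d := ⟨by omega⟩
  obtain ⟨b₁, b₂, hb₁, hb₂, hb⟩ := h.exists_cyl_blockSwap_comparison hU
  refine ⟨b₁, b₂, hb₁, hb₂, fun r s hr _ w => ?_⟩
  obtain ⟨h₁, h₂⟩ := cylinder_comparison_of_blockSwap (hb r s hr) w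
  refine ⟨h₁, h₂, ?_⟩
  rw [pos_iff_ne_zero, pos_iff_ne_zero, ← measureReal_ne_zero_iff, ← measureReal_ne_zero_iff,
    ← measureReal_nonneg.lt_iff_ne', ← measureReal_nonneg.lt_iff_ne']
  exact ⟨fun hp => (mul_pos hb₁ hp).trans_le h₁,
    fun hp => pos_of_mul_pos_right (hp.trans_le h₂) hb₂.le⟩
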